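/- arXiv:1105.3665 — 2 statements merged into one kernel-verified Lean document; each statement's English description precedes it below -/
import Mathlib

section
/- Let G = (V,E) be a finite simple graph with maximal degree Δ, let P be the Swendsen–Wang transition matrix, P_HB the heat-bath transition matrix, and Q = P_HB · P · P_HB. Then for all σ,τ ∈ Ω_P, Q(σ,τ) ≤ q · c₃^{2Δ} · P(σ,τ), where c₃ = q·e^{2β} − (q−1)·e^{β}. -/
open Finset

noncomputable section

/-- Number of connected components of the graph `(V, A)`, counting isolated vertices. -/
def numComp {V : Type*} (A : Finset (Sym2 V)) : ℕ :=
  Nat.card (SimpleGraph.fromEdgeSet (↑A : Set (Sym2 V))).ConnectedComponent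

/-- The set `E(σ)` of edges of `G` whose endpoints receive the same color under `σ`. -/
def monoEdges {V : Type*} [Fintype V] [DecidableEq V] (G : SimpleGraph V)
    [DecidableRel G.Adj] {q : ℕ} (σ : V → Fin q) : Finset (Sym2 V) :=
  G.edgeFinset.filter fun e => ∀ u ∈ e, ∀ w ∈ e, σ u = σ w

/-- The Swendsen–Wang transition matrix on `Ω_P = [q]^V`, with `p = 1 - e^{-β}`. -/
def SW {V : Type*} [Fintype V] [DecidableEq V] (G : SimpleGraph V) [DecidableRel G.Adj]
    (β : ℝ) (q : ℕ) (σ τ : V → Fin q) : ℝ :=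
  ∑ A ∈ (monoEdges G σ ∩ monoEdges G τ).powerset,
    (1 - Real.exp (-β)) ^ A.card * Real.exp (-β) ^ ((monoEdges G σ).card - A.card) *
      ((q : ℝ) ^ numComp A)⁻¹

/-- Partition function `Z(G,β,q)`. -/
def pottsZ {V : Type*} [Fintype V] [DecidableEq V] (G : SimpleGraph V) [DecidableRel G.Adj]
    (β : ℝ) (q : ℕ) : ℝ :=
  ∑ σ : V → Fin q, Real.exp (β * (monoEdges G σ).card)

/-- Boltzmann distribution `π_β` of the `q`-state Potts model on `G`. -/
def potts {V : Type*} [Fintype V] [DecidableEq V] (G : SimpleGraph V) [DecidableRel G.Adj]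
    (β : ℝ) (q : ℕ) (σ : V → Fin q) : ℝ :=
  Real.exp (β * (monoEdges G σ).card) / pottsZ G β q

/-- Heat-bath (single-site Glauber) transition matrix on `Ω_P`. -/
def HB {V : Type*} [Fintype V] [DecidableEq V] (G : SimpleGraph V) [DecidableRel G.Adj]
    (β : ℝ) (q : ℕ) (σ τ : V → Fin q) : ℝ :=
  ((Fintype.card V : ℝ))⁻¹ * ∑ v : V, ∑ k : Fin q,
    if τ = Function.update σ v k then
      potts G β q (Function.update σ v k) / ∑ l : Fin q, potts G β q (Function.update σ v l)
    else 0

/-- `L₂(ν)`-norm of `f`. -/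
def l2norm {Ω : Type*} [Fintype Ω] (ν : Ω → ℝ) (f : Ω → ℝ) : ℝ :=
  Real.sqrt (∑ x, f x ^ 2 * ν x)

/-- Operator norm of the matrix `M` acting on `L₂(ν)`. -/
def opNorm {Ω : Type*} [Fintype Ω] (ν : Ω → ℝ) (M : Ω → Ω → ℝ) : ℝ :=
  sSup {r : ℝ | ∃ f : Ω → ℝ, l2norm ν f ≤ 1 ∧ r = l2norm ν fun x => ∑ y, M x y * f y}

/-- Spectral gap `λ(M) = 1 - ‖M - S_ν‖_ν` of a Markov kernel `M` reversible w.r.t. `ν`. -/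
def specGap {Ω : Type*} [Fintype Ω] (ν : Ω → ℝ) (M : Ω → Ω → ℝ) : ℝ :=
  1 - opNorm ν fun x y => M x y - ν y

/-- Matrix product. -/
def matMul {Ω : Type*} [Fintype Ω] (M N : Ω → Ω → ℝ) : Ω → Ω → ℝ :=
  fun x y => ∑ z, M x z * N z y

end

noncomputable section

section ConnectedComponents

variable {V : Type*}

theorem reachable_fromEdgeSet_insert {S : Set (Sym2 V)} {u w a b : V}
    (h : (SimpleGraph.fromEdgeSet (insert s(u, w) S)).Reachable a b) :
    (SimpleGraph.fromEdgeSet S).Reachable a b ∨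
      ((SimpleGraph.fromEdgeSet S).Reachable a u ∧ (SimpleGraph.fromEdgeSet S).Reachable w b) ∨
      ((SimpleGraph.fromEdgeSet S).Reachable a w ∧ (SimpleGraph.fromEdgeSet S).Reachable u b) := by
  obtain ⟨p⟩ := h
  induction p with
  | nil => exact Or.inl (SimpleGraph.Reachable.refl _)
  | @cons a c b hac _ ih =>
    rw [SimpleGraph.fromEdgeSet_adj] at hac
    obtain ⟨hmem | hmem, hne⟩ := hac
    · rcases Sym2.eq_iff.mp hmem with ⟨rfl, rfl⟩ | ⟨rfl, rfl⟩
      · rcases ih with h | ⟨-, h⟩ | ⟨-, h⟩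
        · exact Or.inr (Or.inl ⟨SimpleGraph.Reachable.refl _, h⟩)
        · exact Or.inr (Or.inl ⟨SimpleGraph.Reachable.refl _, h⟩)
        · exact Or.inl h
      · rcases ih with h | ⟨-, h⟩ | ⟨-, h⟩
        · exact Or.inr (Or.inr ⟨SimpleGraph.Reachable.refl _, h⟩)
        · exact Or.inl h
        · exact Or.inr (Or.inr ⟨SimpleGraph.Reachable.refl _, h⟩)
    · have hr : (SimpleGraph.fromEdgeSet S).Reachable a c :=
        SimpleGraph.Adj.reachable ((SimpleGraph.fromEdgeSet_adj S).mpr ⟨hmem, hne⟩)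
      rcases ih with h | ⟨h, h'⟩ | ⟨h, h'⟩
      · exact Or.inl (hr.trans h)
      · exact Or.inr (Or.inl ⟨hr.trans h, h'⟩)
      · exact Or.inr (Or.inr ⟨hr.trans h, h'⟩)

theorem numComp_le_numComp_insert_add_one [Finite V] [DecidableEq V]
    (A : Finset (Sym2 V)) (e : Sym2 V) :
    numComp A ≤ numComp (insert e A) + 1 := by
  classical
  induction e using Sym2.ind with
  | _ u w =>
  have hle : SimpleGraph.fromEdgeSet (A : Set (Sym2 V)) ≤
      SimpleGraph.fromEdgeSet ((insert s(u, w) A : Finset (Sym2 V)) : Set (Sym2 V)) :=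
    SimpleGraph.fromEdgeSet_mono (by simp)
  unfold numComp
  rw [← Finite.card_option]
  refine Nat.card_le_card_of_injective
    (fun c => if c = (SimpleGraph.fromEdgeSet (A : Set (Sym2 V))).connectedComponentMk u then none
      else some (c.map (SimpleGraph.Hom.ofLE hle))) ?_
  intro c d
  induction c using SimpleGraph.ConnectedComponent.ind with
  | _ a =>
  induction d using SimpleGraph.ConnectedComponent.ind with
  | _ b =>
  intro hcd
  by_cases ha : (SimpleGraph.fromEdgeSet (A : Set (Sym2 V))).connectedComponentMk a =
      (SimpleGraph.fromEdgeSet (A : Set (Sym2 V))).connectedComponentMk u <;>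
    by_cases hb : (SimpleGraph.fromEdgeSet (A : Set (Sym2 V))).connectedComponentMk b =
      (SimpleGraph.fromEdgeSet (A : Set (Sym2 V))).connectedComponentMk u
  · rw [ha, hb]
  · simp [ha, hb] at hcd
  · simp [ha, hb] at hcd
  · simp only [ha, hb, if_false, Option.some.injEq, SimpleGraph.ConnectedComponent.map_mk,
      SimpleGraph.ConnectedComponent.eq, SimpleGraph.Hom.coe_ofLE, id, Finset.coe_insert] at hcd
    rw [SimpleGraph.ConnectedComponent.eq] at ha hb ⊢
    rcases reachable_fromEdgeSet_insert hcd with h | ⟨h, -⟩ | ⟨-, h⟩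
    · exact h
    · exact absurd h ha
    · exact absurd h.symm hb

end ConnectedComponents

/-- The random-cluster sum `∑_{A ⊆ E} x^{|A|} q^{-C(A)}`. -/
def clusterSum {V : Type*} (q : ℕ) (x : ℝ) (E : Finset (Sym2 V)) : ℝ :=
  ∑ A ∈ E.powerset, x ^ A.card * ((q : ℝ) ^ numComp A)⁻¹

section ClusterSum

variable {V : Type*} {q : ℕ} {x : ℝ}

theorem clusterSum_nonneg (hx : 0 ≤ x) (E : Finset (Sym2 V)) : 0 ≤ clusterSum q x E :=
  Finset.sum_nonneg fun _ _ => by positivity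

theorem clusterSum_mono (hx : 0 ≤ x) {E F : Finset (Sym2 V)} (h : E ⊆ F) :
    clusterSum q x E ≤ clusterSum q x F :=
  Finset.sum_le_sum_of_subset_of_nonneg (Finset.powerset_mono.mpr h)
    fun _ _ _ => by positivity

variable [Finite V] [DecidableEq V]

theorem clusterSum_insert_le (hq : 1 ≤ q) (hx : 0 ≤ x) (e : Sym2 V) (E : Finset (Sym2 V)) :
    clusterSum q x (insert e E) ≤ (1 + q * x) * clusterSum q x E := by
  by_cases he : e ∈ E
  · rw [Finset.insert_eq_of_mem he]
    nlinarith [mul_nonneg (mul_nonneg q.cast_nonneg hx) (clusterSum_nonneg (q := q) hx E)]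
  have hq' : (1 : ℝ) ≤ q := by exact_mod_cast hq
  have hq0 : (0 : ℝ) < q := by linarith
  unfold clusterSum
  rw [Finset.sum_powerset_insert he, add_mul, one_mul, Finset.mul_sum]
  refine add_le_add_right (Finset.sum_le_sum fun A hA => ?_) _
  have heA : e ∉ A := fun h => he (Finset.mem_powerset.mp hA h)
  rw [Finset.card_insert_of_notMem heA, pow_succ]
  have hpow : ((q : ℝ) ^ numComp (insert e A))⁻¹ ≤ q * ((q : ℝ) ^ numComp A)⁻¹ := by
    rw [← div_eq_mul_inv, inv_eq_one_div, div_le_div_iff₀ (by positivity) (by positivity), one_mul,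
      ← pow_succ']
    exact pow_le_pow_right₀ hq' (numComp_le_numComp_insert_add_one A e)
  calc x ^ A.card * x * ((q : ℝ) ^ numComp (insert e A))⁻¹
      ≤ x ^ A.card * x * (q * ((q : ℝ) ^ numComp A)⁻¹) := by gcongr
    _ = q * x * (x ^ A.card * ((q : ℝ) ^ numComp A)⁻¹) := by ring

theorem clusterSum_union_le (hq : 1 ≤ q) (hx : 0 ≤ x) (E D : Finset (Sym2 V)) :
    clusterSum q x (D ∪ E) ≤ (1 + q * x) ^ D.card * clusterSum q x E := by
  induction D using Finset.induction_on with
  | empty => simp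
  | insert e D he ih =>
    rw [Finset.insert_union, Finset.card_insert_of_notMem he, pow_succ', mul_assoc]
    exact (clusterSum_insert_le hq hx e _).trans (by gcongr)

theorem clusterSum_le_of_subset_union (hq : 1 ≤ q) (hx : 0 ≤ x) {E F D : Finset (Sym2 V)}
    (h : F ⊆ D ∪ E) {n : ℕ} (hD : D.card ≤ n) :
    clusterSum q x F ≤ (1 + q * x) ^ n * clusterSum q x E := by
  refine (clusterSum_mono hx h).trans ((clusterSum_union_le hq hx E D).trans ?_)
  gcongr
  · exact clusterSum_nonneg hx E
  · exact le_add_of_nonneg_right (by positivity)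

end ClusterSum

theorem inv_card_mul_sum_le {V : Type*} [Fintype V] [Nonempty V] {f : V → ℝ} {c : ℝ} (h : ∀ v, f v ≤ c) :
    ((Fintype.card V : ℝ))⁻¹ * ∑ v, f v ≤ c := by
  have hV : (0 : ℝ) < Fintype.card V := by exact_mod_cast Fintype.card_pos
  rw [inv_mul_le_iff₀ hV, ← nsmul_eq_mul, Fintype.card]
  exact Finset.sum_le_card_nsmul _ _ _ fun v _ => h v

section Dynamics

variable {V : Type*} [Fintype V] [DecidableEq V] (G : SimpleGraph V) [DecidableRel G.Adj]
  {q : ℕ} {β : ℝ}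

theorem monoEdges_subset_incidenceFinset_union {σ τ : V → Fin q} {v : V}
    (h : ∀ u, u ≠ v → σ u = τ u) :
    monoEdges G σ ⊆ G.incidenceFinset v ∪ monoEdges G τ := by
  intro e he
  simp only [monoEdges, Finset.mem_filter, Finset.mem_union, SimpleGraph.mem_edgeFinset,
    SimpleGraph.mem_incidenceFinset, SimpleGraph.incidenceSet, Set.mem_ofPred_eq] at he ⊢
  by_cases hv : v ∈ e
  · exact Or.inl ⟨he.1, hv⟩
  · refine Or.inr ⟨he.1, fun u hu w hw => ?_⟩
    rw [← h u (fun huv => hv (huv ▸ hu)), ← h w (fun hwv => hv (hwv ▸ hw))]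
    exact he.2 u hu w hw

theorem card_incidenceFinset_le_maxDegree (v : V) :
    (G.incidenceFinset v).card ≤ G.maxDegree := by
  rw [G.card_incidenceFinset_eq_degree]
  exact G.degree_le_maxDegree v

theorem SW_eq_clusterSum (σ τ : V → Fin q) :
    SW G β q σ τ = Real.exp (-β) ^ (monoEdges G σ).card *
      clusterSum q (Real.exp β - 1) (monoEdges G σ ∩ monoEdges G τ) := by
  unfold SW clusterSum
  rw [Finset.mul_sum]
  refine Finset.sum_congr rfl fun A hA => ?_
  have hcard : A.card ≤ (monoEdges G σ).card :=
    Finset.card_le_card ((Finset.mem_powerset.mp hA).trans Finset.inter_subset_left)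
  have hx : 1 - Real.exp (-β) = Real.exp (-β) * (Real.exp β - 1) := by
    rw [mul_sub, ← Real.exp_add]
    simp
  rw [hx, mul_pow, ← pow_sub_mul_pow (Real.exp (-β)) hcard]
  ring

variable {G}

theorem SW_nonneg (hβ : 0 ≤ β) (σ τ : V → Fin q) : 0 ≤ SW G β q σ τ := by
  rw [SW_eq_clusterSum]
  exact mul_nonneg (by positivity)
    (clusterSum_nonneg (sub_nonneg.mpr (Real.one_le_exp hβ)) _)

theorem SW_le_of_eq_off_right (hq : 1 ≤ q) (hβ : 0 ≤ β) (σ : V → Fin q) {τ τ' : V → Fin q}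
    {v : V} (h : ∀ u, u ≠ v → τ' u = τ u) :
    SW G β q σ τ' ≤ (1 + q * (Real.exp β - 1)) ^ G.maxDegree * SW G β q σ τ := by
  rw [SW_eq_clusterSum, SW_eq_clusterSum, mul_left_comm]
  gcongr
  refine clusterSum_le_of_subset_union hq (sub_nonneg.mpr (Real.one_le_exp hβ)) ?_
    (card_incidenceFinset_le_maxDegree G v)
  rw [Finset.union_inter_distrib_left]
  exact Finset.inter_subset_inter Finset.subset_union_right
    (monoEdges_subset_incidenceFinset_union G h)

theorem SW_le_of_eq_off_left (hq : 1 ≤ q) (hβ : 0 ≤ β) {σ σ' : V → Fin q} (τ : V → Fin q)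
    {v : V} (h : ∀ u, u ≠ v → σ' u = σ u) :
    SW G β q σ' τ ≤
      (Real.exp β * (1 + q * (Real.exp β - 1))) ^ G.maxDegree * SW G β q σ τ := by
  have hx : 0 ≤ Real.exp β - 1 := sub_nonneg.mpr (Real.one_le_exp hβ)
  have hcluster : clusterSum q (Real.exp β - 1) (monoEdges G σ' ∩ monoEdges G τ) ≤
      (1 + q * (Real.exp β - 1)) ^ G.maxDegree *
        clusterSum q (Real.exp β - 1) (monoEdges G σ ∩ monoEdges G τ) := by
    refine clusterSum_le_of_subset_union hq hx ?_ (card_incidenceFinset_le_maxDegree G v)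
    rw [Finset.union_inter_distrib_left]
    exact Finset.inter_subset_inter (monoEdges_subset_incidenceFinset_union G h)
      Finset.subset_union_right
  have hcard : (monoEdges G σ).card ≤ G.maxDegree + (monoEdges G σ').card :=
    (Finset.card_le_card
      (monoEdges_subset_incidenceFinset_union G fun u hu => (h u hu).symm)).trans
      ((Finset.card_union_le _ _).trans
        (Nat.add_le_add_right (card_incidenceFinset_le_maxDegree G v) _))
  have hexp : Real.exp (-β) ^ (monoEdges G σ').card ≤
      Real.exp β ^ G.maxDegree * Real.exp (-β) ^ (monoEdges G σ).card := by
    calc Real.exp (-β) ^ (monoEdges G σ').card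
        = Real.exp β ^ G.maxDegree *
            Real.exp (-β) ^ (G.maxDegree + (monoEdges G σ').card) := by
          rw [pow_add, ← mul_assoc, ← mul_pow, ← Real.exp_add]
          simp
      _ ≤ _ := mul_le_mul_of_nonneg_left
          (pow_le_pow_of_le_one (Real.exp_pos _).le (Real.exp_le_one_iff.mpr (by linarith)) hcard)
          (by positivity)
  rw [SW_eq_clusterSum, SW_eq_clusterSum, mul_pow]
  calc _ ≤ (Real.exp β ^ G.maxDegree * Real.exp (-β) ^ (monoEdges G σ).card) *
        ((1 + q * (Real.exp β - 1)) ^ G.maxDegree *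
          clusterSum q (Real.exp β - 1) (monoEdges G σ ∩ monoEdges G τ)) :=
        mul_le_mul hexp hcluster (clusterSum_nonneg hx _) (by positivity)
    _ = _ := by ring

theorem potts_nonneg (σ : V → Fin q) : 0 ≤ potts G β q σ :=
  div_nonneg (Real.exp_pos _).le (Finset.sum_nonneg fun _ _ => (Real.exp_pos _).le)

/-- If all single-site changes of `σ` raise `f` to at most `c`, so does the heat-bath average. -/
theorem sum_HB_mul_le [Nonempty V] (σ : V → Fin q) {f : (V → Fin q) → ℝ} {c : ℝ} (hc : 0 ≤ c)
    (hf : ∀ v k, f (Function.update σ v k) ≤ c) :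
    ∑ ρ, HB G β q σ ρ * f ρ ≤ c := by
  have hrw : ∑ ρ, HB G β q σ ρ * f ρ = ((Fintype.card V : ℝ))⁻¹ * ∑ v : V, ∑ k : Fin q,
      potts G β q (Function.update σ v k) / (∑ l : Fin q, potts G β q (Function.update σ v l)) *
        f (Function.update σ v k) := by
    simp only [HB, mul_assoc, ← Finset.mul_sum]
    congr 1
    simp only [Finset.sum_mul]
    rw [Finset.sum_comm]
    refine Finset.sum_congr rfl fun v _ => ?_
    rw [Finset.sum_comm]
    refine Finset.sum_congr rfl fun k _ => ?_
    simp [ite_mul]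
  rw [hrw]
  refine inv_card_mul_sum_le fun v => ?_
  calc _ ≤ ∑ k : Fin q, potts G β q (Function.update σ v k) /
        (∑ l : Fin q, potts G β q (Function.update σ v l)) * c :=
        Finset.sum_le_sum fun k _ => mul_le_mul_of_nonneg_left (hf v k)
          (div_nonneg (potts_nonneg _) (Finset.sum_nonneg fun _ _ => potts_nonneg _))
    _ = (∑ k : Fin q, potts G β q (Function.update σ v k)) /
        (∑ l : Fin q, potts G β q (Function.update σ v l)) * c := by
        rw [← Finset.sum_mul, ← Finset.sum_div]
    _ ≤ c := mul_le_of_le_one_left hc (div_self_le_one _)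

/-- Heat-bath transition probabilities into `τ` are at most `1` per site and predecessor. -/
theorem HB_le_inv_card_mul_sum (ρ τ : V → Fin q) :
    HB G β q ρ τ ≤ ((Fintype.card V : ℝ))⁻¹ *
      ∑ v : V, ∑ l : Fin q, if ρ = Function.update τ v l then 1 else 0 := by
  unfold HB
  refine mul_le_mul_of_nonneg_left (Finset.sum_le_sum fun v _ => ?_) (by positivity)
  calc _ ≤ ∑ k : Fin q, if τ = Function.update ρ v k then (1 : ℝ) else 0 := by
        refine Finset.sum_le_sum fun k _ => ?_
        split_ifs
        · exact div_le_one_of_le₀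
            (Finset.single_le_sum (f := fun l => potts G β q (Function.update ρ v l))
              (fun _ _ => potts_nonneg _) (Finset.mem_univ k))
            (Finset.sum_nonneg fun _ _ => potts_nonneg _)
        · exact le_rfl
    _ ≤ _ := by
        by_cases h : ρ = Function.update τ v (ρ v)
        · have hk (k : Fin q) (hk : τ = Function.update ρ v k) : k = τ v := by
            rw [hk]
            simp
          calc _ ≤ ∑ k : Fin q, if k = τ v then (1 : ℝ) else 0 := by
                refine Finset.sum_le_sum fun k _ => ?_
                by_cases hτ : τ = Function.update ρ v k
                · rw [if_pos hτ, if_pos (hk k hτ)]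
                · rw [if_neg hτ]
                  positivity
            _ = 1 := by simp
            _ = if ρ = Function.update τ v (ρ v) then (1 : ℝ) else 0 := (if_pos h).symm
            _ ≤ _ := Finset.single_le_sum
                (f := fun l => if ρ = Function.update τ v l then (1 : ℝ) else 0)
                (fun _ _ => by positivity) (Finset.mem_univ (ρ v))
        · rw [Finset.sum_eq_zero]
          · exact Finset.sum_nonneg fun _ _ => by positivity
          · intro k _
            rw [if_neg]
            rintro rfl
            simp at h

theorem sum_mul_HB_le [Nonempty V] (τ : V → Fin q) {f : (V → Fin q) → ℝ} (hf0 : ∀ ρ, 0 ≤ f ρ)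
    {c : ℝ} (hf : ∀ v k, f (Function.update τ v k) ≤ c) :
    ∑ ρ, f ρ * HB G β q ρ τ ≤ q * c := by
  calc _ ≤ ∑ ρ, f ρ * (((Fintype.card V : ℝ))⁻¹ *
        ∑ v : V, ∑ l : Fin q, if ρ = Function.update τ v l then 1 else 0) :=
        Finset.sum_le_sum fun ρ _ =>
          mul_le_mul_of_nonneg_left (HB_le_inv_card_mul_sum ρ τ) (hf0 ρ)
    _ = ((Fintype.card V : ℝ))⁻¹ * ∑ v : V, ∑ l : Fin q, f (Function.update τ v l) := by
        simp only [mul_left_comm (f _), ← Finset.mul_sum]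
        congr 1
        simp only [Finset.mul_sum]
        rw [Finset.sum_comm]
        refine Finset.sum_congr rfl fun v _ => ?_
        rw [Finset.sum_comm]
        simp
    _ ≤ q * c := inv_card_mul_sum_le fun v => by
        simpa using Finset.sum_le_card_nsmul Finset.univ _ c fun l _ => hf v l

end Dynamics

/-- for `Q = P_HB · P · P_HB`, `Q(σ,τ) ≤ q·c₃^{2Δ}·P(σ,τ)` with
`c₃ = q e^{2β} - (q-1) e^β` and `Δ` the maximal degree of `G`. -/
theorem HB_SW_HB_entrywise_comparison
    {V : Type*} [Fintype V] [DecidableEq V] [Nonempty V]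
    (G : SimpleGraph V) [DecidableRel G.Adj]
    (q : ℕ) (hq : 2 ≤ q) (β : ℝ) (hβ : 0 ≤ β) (σ τ : V → Fin q) :
    matMul (HB G β q) (matMul (SW G β q) (HB G β q)) σ τ ≤
      (q : ℝ) * ((q : ℝ) * Real.exp (2 * β) - ((q : ℝ) - 1) * Real.exp β) ^ (2 * G.maxDegree) *
        SW G β q σ τ := by
  have hq1 : 1 ≤ q := by omega
  have hx : 0 ≤ Real.exp β - 1 := sub_nonneg.mpr (Real.one_le_exp hβ)
  have hbase : 0 ≤ 1 + (q : ℝ) * (Real.exp β - 1) := by positivity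
  have hc : (q : ℝ) * Real.exp (2 * β) - ((q : ℝ) - 1) * Real.exp β =
      Real.exp β * (1 + q * (Real.exp β - 1)) := by
    rw [two_mul, Real.exp_add]
    ring
  rw [hc, two_mul, pow_add]
  set c : ℝ := (Real.exp β * (1 + q * (Real.exp β - 1))) ^ G.maxDegree
  have hc0 : 0 ≤ c := by positivity
  have hle : (1 + (q : ℝ) * (Real.exp β - 1)) ^ G.maxDegree ≤ c :=
    pow_le_pow_left₀ hbase (le_mul_of_one_le_left hbase (Real.one_le_exp hβ)) _
  have hright (ρ : V → Fin q) :
      matMul (SW G β q) (HB G β q) ρ τ ≤ q * (c * SW G β q ρ τ) :=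
    sum_mul_HB_le τ (SW_nonneg hβ ρ) fun v k =>
      (SW_le_of_eq_off_right hq1 hβ ρ fun u hu => Function.update_of_ne hu k τ).trans
        (mul_le_mul_of_nonneg_right hle (SW_nonneg hβ ρ τ))
  have hSW := SW_nonneg (G := G) hβ σ τ
  refine sum_HB_mul_le σ (by positivity) fun v k => (hright _).trans ?_
  calc (q : ℝ) * (c * SW G β q (Function.update σ v k) τ)
      ≤ q * (c * (c * SW G β q σ τ)) := by
        gcongr
        exact SW_le_of_eq_off_left hq1 hβ τ fun u hu => Function.update_of_ne hu k σ
    _ = q * (c * c) * SW G β q σ τ := by ring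

end
end

section
/- Let P and Q be stochastic matrices on a finite set Ω, both reversible with respect to the same fully supported probability distribution π, and suppose there is a constant K > 0 such that Q(x,y) ≤ K·P(x,y) for all x,y ∈ Ω. Then λ(P) ≥ (1/(2K²))·λ(Q). -/
open Finset

noncomputable section

/-- For a stochastic matrix, the variance defect of one row, written as a double sum. -/
lemma sum_mul_sq_sub_sq_sum_mul {Ω : Type*} [Fintype Ω] (p f : Ω → ℝ) (hp : ∑ y, p y = 1) :
    ∑ y, p y * f y ^ 2 - (∑ y, p y * f y) ^ 2 =
      1 / 2 * ∑ x, ∑ y, p x * p y * (f x - f y) ^ 2 := by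
  have h : ∀ x, ∑ y, p x * p y * (f x - f y) ^ 2 =
      p x * f x ^ 2 - 2 * (p x * f x) * (∑ y, p y * f y) + p x * ∑ y, p y * f y ^ 2 := by
    intro x
    calc ∑ y, p x * p y * (f x - f y) ^ 2
        = ∑ y, (p x * f x ^ 2 * p y - 2 * (p x * f x) * (p y * f y)
            + p x * (p y * f y ^ 2)) := by
          refine Finset.sum_congr rfl fun y _ => ?_
          ring
      _ = _ := by
          rw [Finset.sum_add_distrib, Finset.sum_sub_distrib, ← Finset.mul_sum,
            ← Finset.mul_sum, ← Finset.mul_sum, hp, mul_one]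
  simp_rw [h]
  rw [Finset.sum_add_distrib, Finset.sum_sub_distrib, ← Finset.sum_mul, ← Finset.sum_mul,
    ← Finset.mul_sum, hp]
  ring

/-- The quantity `‖f‖² - ‖R f‖²` for a reversible stochastic `R`, as a sum of squares. -/
lemma sum_sq_sub_sum_sq_apply {Ω : Type*} [Fintype Ω] (ν : Ω → ℝ) (R : Ω → Ω → ℝ)
    (h1 : ∀ x, ∑ y, R x y = 1) (hrev : ∀ x y, ν x * R x y = ν y * R y x) (f : Ω → ℝ) :
    ∑ x, f x ^ 2 * ν x - ∑ x, (∑ y, R x y * f y) ^ 2 * ν x =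
      1 / 2 * ∑ z, ν z * ∑ x, ∑ y, R z x * R z y * (f x - f y) ^ 2 := by
  have hstat : ∑ x, f x ^ 2 * ν x = ∑ z, ν z * ∑ y, R z y * f y ^ 2 := by
    simp_rw [Finset.mul_sum]
    rw [Finset.sum_comm]
    refine Finset.sum_congr rfl fun y _ => ?_
    calc f y ^ 2 * ν y = ∑ z, f y ^ 2 * ν y * R y z := by rw [← Finset.mul_sum, h1, mul_one]
      _ = _ := Finset.sum_congr rfl fun z _ => by linear_combination f y ^ 2 * hrev y z
  rw [hstat, ← Finset.sum_sub_distrib, Finset.mul_sum]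
  refine Finset.sum_congr rfl fun z _ => ?_
  linear_combination ν z * sum_mul_sq_sub_sq_sum_mul (R z) f (h1 z)

/-- A reversible stochastic matrix contracts `L₂(ν)`. -/
lemma sum_sq_apply_le {Ω : Type*} [Fintype Ω] (ν : Ω → ℝ) (hν : ∀ x, 0 < ν x) (R : Ω → Ω → ℝ)
    (h0 : ∀ x y, 0 ≤ R x y) (h1 : ∀ x, ∑ y, R x y = 1)
    (hrev : ∀ x y, ν x * R x y = ν y * R y x) (f : Ω → ℝ) :
    ∑ x, (∑ y, R x y * f y) ^ 2 * ν x ≤ ∑ x, f x ^ 2 * ν x := by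
  have h := sum_sq_sub_sum_sq_apply ν R h1 hrev f
  have : 0 ≤ ∑ z, ν z * ∑ x, ∑ y, R z x * R z y * (f x - f y) ^ 2 :=
    Finset.sum_nonneg fun z _ => mul_nonneg (hν z).le <| Finset.sum_nonneg fun x _ =>
      Finset.sum_nonneg fun y _ =>
        mul_nonneg (mul_nonneg (h0 z x) (h0 z y)) (sq_nonneg _)
  linarith

/-- Comparison of the defects `‖f‖² - ‖R f‖²` under an entrywise bound. -/
lemma sum_sq_sub_sum_sq_apply_le {Ω : Type*} [Fintype Ω] (ν : Ω → ℝ) (hν : ∀ x, 0 < ν x)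
    (P Q : Ω → Ω → ℝ) (hP1 : ∀ x, ∑ y, P x y = 1)
    (hQ0 : ∀ x y, 0 ≤ Q x y) (hQ1 : ∀ x, ∑ y, Q x y = 1)
    (hPrev : ∀ x y, ν x * P x y = ν y * P y x) (hQrev : ∀ x y, ν x * Q x y = ν y * Q y x)
    (K : ℝ) (hcomp : ∀ x y, Q x y ≤ K * P x y) (f : Ω → ℝ) :
    ∑ x, f x ^ 2 * ν x - ∑ x, (∑ y, Q x y * f y) ^ 2 * ν x ≤
      K ^ 2 * (∑ x, f x ^ 2 * ν x - ∑ x, (∑ y, P x y * f y) ^ 2 * ν x) := by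
  rw [sum_sq_sub_sum_sq_apply ν P hP1 hPrev, sum_sq_sub_sum_sq_apply ν Q hQ1 hQrev]
  have : ∑ z, ν z * ∑ x, ∑ y, Q z x * Q z y * (f x - f y) ^ 2 ≤
      K ^ 2 * ∑ z, ν z * ∑ x, ∑ y, P z x * P z y * (f x - f y) ^ 2 := by
    simp_rw [Finset.mul_sum]
    refine Finset.sum_le_sum fun z _ => Finset.sum_le_sum fun x _ =>
      Finset.sum_le_sum fun y _ => ?_
    have hQP : Q z x * Q z y ≤ (K * P z x) * (K * P z y) :=
      mul_le_mul (hcomp z x) (hcomp z y) (hQ0 z y) ((hQ0 z x).trans (hcomp z x))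
    calc ν z * (Q z x * Q z y * (f x - f y) ^ 2)
        ≤ ν z * ((K * P z x) * (K * P z y) * (f x - f y) ^ 2) :=
          mul_le_mul_of_nonneg_left (mul_le_mul_of_nonneg_right hQP (sq_nonneg _)) (hν z).le
      _ = _ := by ring
  linarith

/-- Subtracting `S_ν` from a stochastic matrix amounts to centring the argument. -/
lemma sum_sub_mul_eq_sum_mul_sub {Ω : Type*} [Fintype Ω] (ν : Ω → ℝ) (R : Ω → Ω → ℝ)
    (h1 : ∀ x, ∑ y, R x y = 1) (f : Ω → ℝ) (x : Ω) :
    ∑ y, (R x y - ν y) * f y = ∑ y, R x y * (f y - ∑ z, ν z * f z) := by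
  simp_rw [sub_mul, mul_sub, Finset.sum_sub_distrib]
  rw [← Finset.sum_mul, h1, one_mul]

/-- Centring does not increase the `L₂(ν)`-norm. -/
lemma sum_sq_sub_mean_le {Ω : Type*} [Fintype Ω] (ν : Ω → ℝ) (hν : ∑ x, ν x = 1) (f : Ω → ℝ) :
    ∑ x, (f x - ∑ z, ν z * f z) ^ 2 * ν x ≤ ∑ x, f x ^ 2 * ν x := by
  set m := ∑ z, ν z * f z with hm
  have : ∑ x, (f x - m) ^ 2 * ν x = ∑ x, f x ^ 2 * ν x - m ^ 2 := by
    calc ∑ x, (f x - m) ^ 2 * ν x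
        = ∑ x, (f x ^ 2 * ν x - 2 * m * (ν x * f x) + m ^ 2 * ν x) :=
          Finset.sum_congr rfl fun x _ => by ring
      _ = _ := by
          rw [Finset.sum_add_distrib, Finset.sum_sub_distrib, ← Finset.mul_sum,
            ← Finset.mul_sum, hν, ← hm]
          ring
  linarith [sq_nonneg m]

lemma sum_mul_sub_mean_eq_zero {Ω : Type*} [Fintype Ω] (ν : Ω → ℝ) (hν : ∑ x, ν x = 1)
    (f : Ω → ℝ) : ∑ x, ν x * (f x - ∑ z, ν z * f z) = 0 := by
  simp_rw [mul_sub, Finset.sum_sub_distrib]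
  rw [← Finset.sum_mul, hν, one_mul, sub_self]

lemma l2norm_nonneg {Ω : Type*} [Fintype Ω] (ν f : Ω → ℝ) : 0 ≤ l2norm ν f :=
  Real.sqrt_nonneg _

lemma l2norm_le_one_iff {Ω : Type*} [Fintype Ω] (ν f : Ω → ℝ) :
    l2norm ν f ≤ 1 ↔ ∑ x, f x ^ 2 * ν x ≤ 1 := by
  simp [l2norm]

lemma sq_l2norm {Ω : Type*} [Fintype Ω] (ν : Ω → ℝ) (hν : ∀ x, 0 < ν x) (f : Ω → ℝ) :
    l2norm ν f ^ 2 = ∑ x, f x ^ 2 * ν x :=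
  Real.sq_sqrt (Finset.sum_nonneg fun x _ => mul_nonneg (sq_nonneg _) (hν x).le)

lemma opNorm_le {Ω : Type*} [Fintype Ω] (ν : Ω → ℝ) (M : Ω → Ω → ℝ) (c : ℝ)
    (h : ∀ f, l2norm ν f ≤ 1 → l2norm ν (fun x => ∑ y, M x y * f y) ≤ c) :
    opNorm ν M ≤ c := by
  refine csSup_le ⟨_, 0, by simp [l2norm], rfl⟩ ?_
  rintro r ⟨f, hf, rfl⟩
  exact h f hf

lemma opNorm_nonneg {Ω : Type*} [Fintype Ω] (ν : Ω → ℝ) (M : Ω → Ω → ℝ) : 0 ≤ opNorm ν M := by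
  refine Real.sSup_nonneg ?_
  rintro r ⟨f, _, rfl⟩
  exact l2norm_nonneg _ _

lemma l2norm_sub_apply_le_one {Ω : Type*} [Fintype Ω] (ν : Ω → ℝ) (hν : ∀ x, 0 < ν x)
    (hνsum : ∑ x, ν x = 1) (R : Ω → Ω → ℝ) (h0 : ∀ x y, 0 ≤ R x y) (h1 : ∀ x, ∑ y, R x y = 1)
    (hrev : ∀ x y, ν x * R x y = ν y * R y x)
    (f : Ω → ℝ) (hf : l2norm ν f ≤ 1) :
    l2norm ν (fun x => ∑ y, (R x y - ν y) * f y) ≤ 1 := by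
  rw [l2norm_le_one_iff] at hf ⊢
  simp_rw [sum_sub_mul_eq_sum_mul_sub ν R h1 f]
  exact (sum_sq_apply_le ν hν R h0 h1 hrev _).trans ((sum_sq_sub_mean_le ν hνsum f).trans hf)

lemma opNorm_sub_le_one {Ω : Type*} [Fintype Ω] (ν : Ω → ℝ) (hν : ∀ x, 0 < ν x)
    (hνsum : ∑ x, ν x = 1) (R : Ω → Ω → ℝ) (h0 : ∀ x y, 0 ≤ R x y) (h1 : ∀ x, ∑ y, R x y = 1)
    (hrev : ∀ x y, ν x * R x y = ν y * R y x) : opNorm ν (fun x y => R x y - ν y) ≤ 1 :=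
  opNorm_le _ _ _ (l2norm_sub_apply_le_one ν hν hνsum R h0 h1 hrev)

lemma l2norm_sub_apply_le_opNorm {Ω : Type*} [Fintype Ω] (ν : Ω → ℝ) (hν : ∀ x, 0 < ν x)
    (hνsum : ∑ x, ν x = 1) (R : Ω → Ω → ℝ) (h0 : ∀ x y, 0 ≤ R x y) (h1 : ∀ x, ∑ y, R x y = 1)
    (hrev : ∀ x y, ν x * R x y = ν y * R y x)
    (f : Ω → ℝ) (hf : l2norm ν f ≤ 1) :
    l2norm ν (fun x => ∑ y, (R x y - ν y) * f y) ≤ opNorm ν (fun x y => R x y - ν y) := by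
  refine le_csSup ⟨1, ?_⟩ ⟨f, hf, rfl⟩
  rintro r ⟨g, hg, rfl⟩
  exact l2norm_sub_apply_le_one ν hν hνsum R h0 h1 hrev g hg

lemma sum_sq_apply_le_opNorm_sq_mul {Ω : Type*} [Fintype Ω] (ν : Ω → ℝ) (hν : ∀ x, 0 < ν x)
    (hνsum : ∑ x, ν x = 1) (R : Ω → Ω → ℝ) (h0 : ∀ x y, 0 ≤ R x y) (h1 : ∀ x, ∑ y, R x y = 1)
    (hrev : ∀ x y, ν x * R x y = ν y * R y x)
    (g : Ω → ℝ) (hg : ∑ x, ν x * g x = 0) :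
    ∑ x, (∑ y, R x y * g y) ^ 2 * ν x ≤
      opNorm ν (fun x y => R x y - ν y) ^ 2 * ∑ x, g x ^ 2 * ν x := by
  rw [← sq_l2norm ν hν g, ← sq_l2norm ν hν (fun x => ∑ y, R x y * g y)]
  rcases (l2norm_nonneg ν g).eq_or_lt with h | h
  · have := sum_sq_apply_le ν hν R h0 h1 hrev g
    rw [← sq_l2norm ν hν g, ← sq_l2norm ν hν (fun x => ∑ y, R x y * g y), ← h] at this
    rw [← h]
    simpa using this
  · set c := l2norm ν g with hc
    have hscale : l2norm ν (fun x => c⁻¹ * g x) ≤ 1 := by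
      rw [l2norm_le_one_iff]
      simp_rw [mul_pow, mul_assoc]
      rw [← Finset.mul_sum, ← sq_l2norm ν hν g, ← hc, ← mul_pow, inv_mul_cancel₀ h.ne', one_pow]
    have key := pow_le_pow_left₀ (l2norm_nonneg _ _)
      (l2norm_sub_apply_le_opNorm ν hν hνsum R h0 h1 hrev _ hscale) 2
    have hs : ∀ x, ∑ y, (R x y - ν y) * (c⁻¹ * g y) = c⁻¹ * ∑ y, R x y * g y := by
      intro x
      rw [sum_sub_mul_eq_sum_mul_sub ν R h1]
      have hz : ∑ z, ν z * (c⁻¹ * g z) = 0 := by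
        simp_rw [mul_left_comm _ c⁻¹]
        rw [← Finset.mul_sum, hg, mul_zero]
      simp_rw [hz, sub_zero, mul_left_comm _ c⁻¹]
      rw [← Finset.mul_sum]
    simp_rw [hs] at key
    rw [sq_l2norm ν hν] at key
    simp_rw [mul_pow, mul_assoc] at key
    rw [← Finset.mul_sum, ← sq_l2norm ν hν (fun x => ∑ y, R x y * g y), inv_pow,
      inv_mul_le_iff₀ (by positivity), mul_comm] at key
    exact key

/-- abstract comparison argument: if `P, Q` are stochastic matrices on a
finite set, both reversible w.r.t. the same fully supported distribution `π`, and
`Q(x,y) ≤ K·P(x,y)` entrywise for some `K > 0`, then `λ(P) ≥ (2K²)⁻¹·λ(Q)`. -/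
theorem gap_comparison_of_entrywise_bound
    {Ω : Type*} [Fintype Ω]
    (π : Ω → ℝ) (hπpos : ∀ x, 0 < π x) (hπsum : ∑ x, π x = 1)
    (P Q : Ω → Ω → ℝ)
    (hP0 : ∀ x y, 0 ≤ P x y) (hP1 : ∀ x, ∑ y, P x y = 1)
    (hQ0 : ∀ x y, 0 ≤ Q x y) (hQ1 : ∀ x, ∑ y, Q x y = 1)
    (hPrev : ∀ x y, π x * P x y = π y * P y x)
    (hQrev : ∀ x y, π x * Q x y = π y * Q y x)
    (K : ℝ) (hK : 0 < K) (hcomp : ∀ x y, Q x y ≤ K * P x y) :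
    specGap π P ≥ (1 / (2 * K ^ 2)) * specGap π Q := by
  have hK1 : 1 ≤ K := by
    obtain ⟨x⟩ : Nonempty Ω := by
      by_contra hne
      rw [not_nonempty_iff] at hne
      simp at hπsum
    calc (1 : ℝ) = ∑ y, Q x y := (hQ1 x).symm
      _ ≤ ∑ y, K * P x y := Finset.sum_le_sum fun y _ => hcomp x y
      _ = K := by rw [← Finset.mul_sum, hP1, mul_one]
  unfold specGap
  set q := opNorm π (fun x y => Q x y - π y) with hq
  have hq0 : 0 ≤ q := opNorm_nonneg _ _
  have hq1 : q ≤ 1 := opNorm_sub_le_one π hπpos hπsum Q hQ0 hQ1 hQrev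
  set t := 1 / (2 * K ^ 2) * (1 - q) with ht
  have hKt : K ^ 2 * (2 * t) = 1 - q := by
    rw [ht]
    field_simp
  have ht1 : t ≤ 1 := by nlinarith
  suffices opNorm π (fun x y => P x y - π y) ≤ 1 - t by linarith
  refine opNorm_le _ _ _ fun f hf => ?_
  refine Real.sqrt_le_iff.2 ⟨by linarith, ?_⟩
  simp_rw [sum_sub_mul_eq_sum_mul_sub π P hP1 f]
  rw [l2norm_le_one_iff] at hf
  have hg := (sum_sq_sub_mean_le π hπsum f).trans hf
  have hmean := sum_mul_sub_mean_eq_zero π hπsum f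
  set g : Ω → ℝ := fun y => f y - ∑ z, π z * f z
  have hQg := sum_sq_apply_le_opNorm_sq_mul π hπpos hπsum Q hQ0 hQ1 hQrev g hmean
  have hcmp := sum_sq_sub_sum_sq_apply_le π hπpos P Q hP1 hQ0 hQ1 hPrev hQrev K hcomp g
  have hN : 0 ≤ ∑ x, g x ^ 2 * π x :=
    Finset.sum_nonneg fun x _ => mul_nonneg (sq_nonneg _) (hπpos x).le
  change ∑ x, g x ^ 2 * π x ≤ 1 at hg
  change ∑ x, (∑ y, P x y * g y) ^ 2 * π x ≤ _
  set N := ∑ x, g x ^ 2 * π x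
  have hdefect : K ^ 2 * (2 * t * N) ≤
      K ^ 2 * (N - ∑ x, (∑ y, P x y * g y) ^ 2 * π x) := by
    refine le_trans ?_ hcmp
    have : q ^ 2 * N ≤ q * N := mul_le_mul_of_nonneg_right (by nlinarith) hN
    rw [← mul_assoc, hKt]
    linarith
  have := le_of_mul_le_mul_left hdefect (by positivity)
  nlinarith [mul_nonneg hN (sq_nonneg t), mul_le_mul_of_nonneg_left hg (sq_nonneg (1 - t))]

end
end
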